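/- The autonomous Stommel system dT/dt = η₁ − T(1+|T−S|), dS/dt = η₂ − S(η₃+|T−S|) with 0 < η₃ < 1 and η₁ > η₃/(1−η₃) has no nonconstant periodic solutions in the region {(T,S) : T ≥ 0, S ≥ 0}. -/

import Mathlib

theorem hasDerivAt_mul_abs_self (x : ℝ) : HasDerivAt (fun y : ℝ => y * |y|) (2 * |x|) x := by
  have key : ∀ y : ℝ, y ≠ 0 → HasDerivAt (fun y : ℝ => y * |y|) (2 * |y|) y := by
    intro y hy
    have h := (hasDerivAt_id y).mul (hasDerivAt_abs hy)
    refine h.congr_deriv ?_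
    rcases lt_or_gt_of_ne hy with h | h
    · simp [h, abs_of_neg h]; ring
    · simp [h, abs_of_pos h]; ring
  by_cases hx : x = 0
  · subst hx
    exact hasDerivAt_of_hasDerivAt_of_ne (f := fun y : ℝ => y * |y|) (g := fun y : ℝ => 2 * |y|)
      (x := 0) key (by fun_prop) (by fun_prop)
  · exact key x hx

/-- The autonomous Stommel system `dT/dt = η₁ − T(1+|T−S|)`,
`dS/dt = η₂ − S(η₃+|T−S|)` with `0 < η₃ < 1` and `η₁ > η₃/(1−η₃)` has no
nonconstant periodic solutions in `{(T,S) : T ≥ 0, S ≥ 0}`: every periodic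
solution staying in the closed first quadrant is constant. -/
theorem stommel_no_periodic_solutions (η₁ η₂ η₃ : ℝ)
    (hη₃ : 0 < η₃) (hη₃' : η₃ < 1) (hη₁ : η₁ > η₃ / (1 - η₃))
    (γ : ℝ → ℝ × ℝ)
    (hODE : ∀ t : ℝ, HasDerivAt γ
      (η₁ - (γ t).1 * (1 + |(γ t).1 - (γ t).2|),
       η₂ - (γ t).2 * (η₃ + |(γ t).1 - (γ t).2|)) t)
    (hquadrant : ∀ t : ℝ, 0 ≤ (γ t).1 ∧ 0 ≤ (γ t).2)
    (P : ℝ) (hP : 0 < P) (hperiodic : ∀ t : ℝ, γ (t + P) = γ t) :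
    ∃ c : ℝ × ℝ, ∀ t : ℝ, γ t = c := by
  have hT : ∀ t, HasDerivAt (fun t => (γ t).1)
      (η₁ - (γ t).1 * (1 + |(γ t).1 - (γ t).2|)) t := fun t =>
    (hasFDerivAt_fst (𝕜 := ℝ) (p := γ t)).comp_hasDerivAt t (hODE t)
  have hS : ∀ t, HasDerivAt (fun t => (γ t).2)
      (η₂ - (γ t).2 * (η₃ + |(γ t).1 - (γ t).2|)) t := fun t =>
    (hasFDerivAt_snd (𝕜 := ℝ) (p := γ t)).comp_hasDerivAt t (hODE t)
  obtain ⟨g, hg⟩ : ∃ g : ℝ → ℝ, g = fun x => η₁ - η₂ - x * |x| - η₃ * x := ⟨_, rfl⟩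
  obtain ⟨x, hxdef⟩ : ∃ x : ℝ → ℝ, x = fun t => (γ t).1 - (γ t).2 := ⟨_, rfl⟩
  obtain ⟨v, hvdef⟩ : ∃ v : ℝ → ℝ, v = fun t => g (x t) - (1 - η₃) * (γ t).1 := ⟨_, rfl⟩
  have hgd : ∀ y, HasDerivAt g (-(2 * |y|) - η₃) y := by
    intro y
    rw [hg]
    have h := (((hasDerivAt_mul_abs_self y).const_sub (η₁ - η₂)).sub
      ((hasDerivAt_id y).const_mul η₃))
    refine h.congr_deriv ?_
    ring
  have hx : ∀ t, HasDerivAt x (v t) t := by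
    intro t
    have h := (hT t).sub (hS t)
    rw [hvdef, hg, hxdef]
    refine h.congr_deriv ?_
    ring
  have hv : ∀ t, HasDerivAt v ((-(2 * |x t|) - η₃) * v t
      - (1 - η₃) * (η₁ - (γ t).1 * (1 + |x t|))) t := by
    intro t
    have h := ((hgd (x t)).comp t (hx t)).sub ((hT t).const_mul (1 - η₃))
    rw [hvdef]
    rw [hvdef, hxdef] at h
    rw [hxdef]
    exact h
  -- potential
  have hgc : Continuous g := by rw [hg]; fun_prop
  obtain ⟨W, hW⟩ : ∃ W : ℝ → ℝ, W = fun y => (1 - η₃) * η₁ - g y * (1 + |y|) := ⟨_, rfl⟩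
  have hWc : Continuous W := by rw [hW]; fun_prop
  obtain ⟨E, hE⟩ : ∃ E : ℝ → ℝ, E = fun t => v t ^ 2 / 2 + ∫ s in (0:ℝ)..(x t), W s := ⟨_, rfl⟩
  have hEd : ∀ t, HasDerivAt E (-((1 + η₃ + 3 * |x t|) * v t ^ 2)) t := by
    intro t
    have hV : HasDerivAt (fun y => ∫ s in (0:ℝ)..y, W s) (W (x t)) (x t) :=
      hWc.integral_hasStrictDerivAt 0 (x t) |>.hasDerivAt
    have h := (((hv t).pow 2).div_const 2).add (hV.comp t (hx t))
    rw [hE]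
    refine h.congr_deriv ?_
    have hg' : g (x t) = v t + (1 - η₃) * (γ t).1 := by rw [hvdef]; ring
    simp only [hW, hg']
    push_cast
    ring
  have hanti : Antitone E := by
    apply antitone_of_deriv_nonpos (fun t => (hEd t).differentiableAt)
    intro t
    rw [(hEd t).deriv]
    have : 0 ≤ (1 + η₃ + 3 * |x t|) * v t ^ 2 := by positivity
    linarith
  have hper : Function.Periodic E P := by
    intro t
    simp only [hE, hvdef, hxdef, hperiodic]
  have hle : ∀ s t, E s ≤ E t := by
    intro s t
    obtain ⟨n, hn⟩ := exists_nat_ge ((t - s) / P)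
    rw [div_le_iff₀ hP] at hn
    have h1 := hper.nat_mul n s
    rw [← h1]
    exact hanti (by linarith)
  have hconst : E = fun _ => E 0 := funext fun t => le_antisymm (hle _ _) (hle _ _)
  have hv0 : ∀ t, v t = 0 := by
    intro t
    have h1 := hEd t
    rw [hconst] at h1
    have h2 := h1.unique (hasDerivAt_const t (E 0))
    have h3 : 0 < 1 + η₃ + 3 * |x t| := by positivity
    have h4 : (1 + η₃ + 3 * |x t|) * v t ^ 2 = 0 := by linarith
    rcases mul_eq_zero.mp h4 with h | h
    · exact absurd h h3.ne'
    · exact pow_eq_zero_iff (two_ne_zero) |>.mp h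
  have hxc : ∀ t, x t = x 0 := fun t =>
    is_const_of_deriv_eq_zero (fun t => (hx t).differentiableAt)
      (fun t => by rw [(hx t).deriv, hv0 t]) t 0
  have hTc : ∀ t, (γ t).1 = (γ 0).1 := by
    intro t
    have h1 := hv0 t
    have h2 := hv0 0
    simp only [hvdef] at h1 h2
    rw [hxc t] at h1
    have h3 : (1 - η₃) * (γ t).1 = (1 - η₃) * (γ 0).1 := by linarith
    exact mul_left_cancel₀ (by linarith) h3
  refine ⟨γ 0, fun t => Prod.ext (hTc t) ?_⟩
  have h1 := hxc t
  simp only [hxdef] at h1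
  linarith [hTc t]
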